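/- Let a : ℕ → ℝ be a lacunary sequence of positive reals (a(x) > 0 and a(x+1) ≥ C·a(x) for all x ≥ 1, with a fixed constant C > 1). Let M ≥ 2C/(C−1) and K > 0 be reals, and let n₁, n₂, x₁, y₁, x₂, y₂ be positive integers with 1 ≤ n₁ ≤ M, 1 ≤ n₂ ≤ M, y₁ < x₁, y₂ < x₂, x₂ ≤ x₁, satisfying |n₁·(a(x₁) − a(y₁)) − n₂·(a(x₂) − a(y₂))| < K. Then either x₁ − x₂ ≤ 2·log M / log C, or (1/2)·(1 − 1/C)·a(x₁) < K. -/

import Mathlib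

/-- Iterating the lacunarity condition `C * a x ≤ a (x + 1)` over `k` steps. -/
theorem pow_mul_le_of_lacunary {a : ℕ → ℝ} {C : ℝ} (hC : 0 ≤ C)
    (hlac : ∀ x : ℕ, 1 ≤ x → C * a x ≤ a (x + 1)) {y : ℕ} (hy : 1 ≤ y) (k : ℕ) :
    C ^ k * a y ≤ a (y + k) := by
  induction k with
  | zero => simp
  | succ k ih =>
    calc C ^ (k + 1) * a y = C * (C ^ k * a y) := by ring
      _ ≤ C * a (y + k) := by gcongr
      _ ≤ a (y + (k + 1)) := hlac (y + k) (by lia)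


/-- For a lacunary sequence of positive reals, for a solution of the
Diophantine inequality `|n₁(a(x₁) − a(y₁)) − n₂(a(x₂) − a(y₂))| < K` with
`1 ≤ nᵢ ≤ M`, `yᵢ < xᵢ`, `x₂ ≤ x₁` and `M ≥ 2C/(C−1)`, either
`x₁ − x₂ ≤ 2·log M/log C` or `(1/2)·(1 − 1/C)·a(x₁) < K`. -/
theorem gap_or_small_leading_term
    (a : ℕ → ℝ) (C : ℝ) (hC : 1 < C)
    (hpos : ∀ x : ℕ, 1 ≤ x → 0 < a x)
    (hlac : ∀ x : ℕ, 1 ≤ x → C * a x ≤ a (x + 1))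
    (M K : ℝ) (hM : 2 * C / (C - 1) ≤ M) (hK : 0 < K)
    (n₁ n₂ x₁ y₁ x₂ y₂ : ℕ)
    (hn₁ : 1 ≤ n₁) (hn₁M : (n₁ : ℝ) ≤ M)
    (hn₂ : 1 ≤ n₂) (hn₂M : (n₂ : ℝ) ≤ M)
    (hy₁ : 1 ≤ y₁) (hy₁x₁ : y₁ < x₁)
    (hy₂ : 1 ≤ y₂) (hy₂x₂ : y₂ < x₂)
    (hx₂x₁ : x₂ ≤ x₁)
    (hineq : |(n₁ : ℝ) * (a x₁ - a y₁) - (n₂ : ℝ) * (a x₂ - a y₂)| < K) :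
    ((x₁ : ℝ) - (x₂ : ℝ)) ≤ 2 * Real.log M / Real.log C ∨
      (1 / 2) * (1 - 1 / C) * a x₁ < K := by
  rw [or_iff_not_imp_left, not_le, div_lt_iff₀ (Real.log_pos hC)]
  intro hgap
  have hC0 : 0 < C := by linarith
  have hC1 : 0 < C - 1 := by linarith
  have hM0 : 0 < M := lt_of_lt_of_le (by positivity) hM
  have hx₁ : 0 < a x₁ := hpos x₁ (by lia)
  have hx₂ : 0 < a x₂ := hpos x₂ (by lia)
  have hpow : M ^ 2 < C ^ (x₁ - x₂) := by
    rw [← Real.log_lt_log_iff (by positivity) (by positivity), Real.log_pow, Real.log_pow,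
      Nat.cast_sub hx₂x₁]
    exact_mod_cast hgap
  have hx₂_le : M * a x₂ ≤ 1 / 2 * (1 - 1 / C) * a x₁ := by
    have hle := pow_mul_le_of_lacunary hC0.le hlac (y := x₂) (by lia) (x₁ - x₂)
    rw [Nat.add_sub_cancel' hx₂x₁] at hle
    have hsq : M ^ 2 * a x₂ ≤ a x₁ := (mul_le_mul_of_nonneg_right hpow.le hx₂.le).trans hle
    have hM' : 1 ≤ 1 / 2 * (1 - 1 / C) * M := by
      rw [div_le_iff₀ hC1] at hM
      have : 1 / 2 * (1 - 1 / C) * M = M * (C - 1) / (2 * C) := by field_simp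
      rw [this, le_div_iff₀ (by positivity)]
      linarith
    have hfac : 0 ≤ 1 / 2 * (1 - 1 / C) := by
      have : 1 / C ≤ 1 := (div_le_one hC0).2 hC.le
      linarith
    calc M * a x₂ = 1 * (M * a x₂) := (one_mul _).symm
      _ ≤ 1 / 2 * (1 - 1 / C) * M * (M * a x₂) := by gcongr
      _ = 1 / 2 * (1 - 1 / C) * (M ^ 2 * a x₂) := by ring
      _ ≤ 1 / 2 * (1 - 1 / C) * a x₁ := by gcongr
  have hy₁_le : a y₁ ≤ 1 / C * a x₁ := by
    have hle := pow_mul_le_of_lacunary hC0.le hlac hy₁ (x₁ - y₁)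
    rw [Nat.add_sub_cancel' hy₁x₁.le] at hle
    have hCpow : C ≤ C ^ (x₁ - y₁) := le_self_pow₀ hC.le (by lia)
    rw [one_div_mul_eq_div, le_div_iff₀ hC0, mul_comm]
    exact (mul_le_mul_of_nonneg_right hCpow (hpos y₁ hy₁).le).trans hle
  have hfirst : a x₁ - a y₁ ≤ n₁ * (a x₁ - a y₁) := by
    have hdiff : 0 ≤ a x₁ - a y₁ := by
      have : 1 / C * a x₁ ≤ 1 * a x₁ := by
        gcongr
        exact (div_le_one hC0).2 hC.le
      linarith
    exact le_mul_of_one_le_left hdiff (by exact_mod_cast hn₁)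
  have hsecond : n₂ * (a x₂ - a y₂) ≤ M * a x₂ :=
    calc (n₂ : ℝ) * (a x₂ - a y₂) ≤ n₂ * a x₂ := by
          gcongr
          linarith [hpos y₂ hy₂]
      _ ≤ M * a x₂ := by gcongr
  linarith [(abs_lt.1 hineq).2]
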